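/- Let A be an integral domain with field of fractions Q(A), let p ∈ Q(A), let Θ = γ/θ be a weakly coprime factorization of the signal generator Θ ∈ Q(A), and suppose there exists a controller that is robustly regulating for p with generator Θ. Then a controller c ∈ Q(A) is robustly regulating for p with generator Θ if and only if c = c₀/θ for some controller c₀ ∈ Q(A) that stabilizes the plant p₀ := p/θ. -/

import Mathlib

/-- An element of the field of fractions `K` is *stable* if it lies in the
canonical image of the ring `A`. -/
def Stable (A : Type*) {K : Type*} [CommRing A] [IsDomain A] [Field K] [Algebra A K]
    [IsFractionRing A K] (h : K) : Prop :=
  h ∈ (algebraMap A K).range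

/-- A controller `c` stabilizes a plant `p` if `p * c ≠ 1` and the three closed-loop
transfer functions `1/(1 - p*c)`, `p/(1 - p*c)` and `c/(1 - p*c)` are all stable. -/
def Stabilizes (A : Type*) {K : Type*} [CommRing A] [IsDomain A] [Field K] [Algebra A K]
    [IsFractionRing A K] (c p : K) : Prop :=
  p * c ≠ 1 ∧ Stable A (1 - p * c)⁻¹ ∧ Stable A (p * (1 - p * c)⁻¹) ∧
    Stable A (c * (1 - p * c)⁻¹)

/-- A controller `c` is *robustly regulating* for the plant `p` with signal generator `Θ`
if it stabilizes `p` and regulates every plant that it stabilizes. -/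
def IsRobustlyRegulating (A : Type*) {K : Type*} [CommRing A] [IsDomain A] [Field K]
    [Algebra A K] [IsFractionRing A K] (Θ p c : K) : Prop :=
  Stabilizes A c p ∧
    ∀ p' : K, Stabilizes A c p' →
      Stable A (Θ * (1 - p' * c)⁻¹) ∧ Stable A (Θ * p' * (1 - p' * c)⁻¹)

section Helpers

variable {A K : Type*} [CommRing A] [IsDomain A] [Field K] [Algebra A K] [IsFractionRing A K]

theorem Stable.mul {x y : K} (hx : Stable A x) (hy : Stable A y) : Stable A (x * y) :=
  (algebraMap A K).range.mul_mem hx hy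

theorem Stable.sub {x y : K} (hx : Stable A x) (hy : Stable A y) : Stable A (x - y) :=
  (algebraMap A K).range.sub_mem hx hy

theorem Stable.one : Stable A (1 : K) :=
  (algebraMap A K).range.one_mem

theorem stable_algebraMap (a : A) : Stable A (algebraMap A K a) :=
  ⟨a, rfl⟩

/-- The sensitivity function `S = (1 - p * c)⁻¹` satisfies `S - p * c * S = 1`. -/
theorem sensitivity_sub {p c : K} (h : p * c ≠ 1) :
    (1 - p * c)⁻¹ - p * (1 - p * c)⁻¹ * c = 1 := by
  have : (1 - p * c) * (1 - p * c)⁻¹ = 1 := mul_inv_cancel₀ (sub_ne_zero.mpr h.symm)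
  linear_combination this

/-- With a weakly coprime factorization `γ / θ` of the signal generator, the closed loop of
a robustly regulating controller is divisible by `θ`. -/
theorem IsRobustlyRegulating.stable_div {p c : K} {γ θ : A} (hθ : θ ≠ 0)
    (hwc : ∀ k : K, Stable A (k * algebraMap A K γ) → Stable A (k * algebraMap A K θ) →
      Stable A k)
    (h : IsRobustlyRegulating A (algebraMap A K γ / algebraMap A K θ) p c) :
    Stable A ((1 - p * c)⁻¹ / algebraMap A K θ) ∧
      Stable A (p * (1 - p * c)⁻¹ / algebraMap A K θ) := by
  have ht : algebraMap A K θ ≠ 0 := by simpa using hθ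
  obtain ⟨hs, hr⟩ := h
  obtain ⟨h₁, h₂⟩ := hr p hs
  constructor
  · apply hwc
    · convert h₁ using 1
      ring
    · rw [div_mul_cancel₀ _ ht]
      exact hs.2.1
  · apply hwc
    · convert h₂ using 1
      ring
    · rw [div_mul_cancel₀ _ ht]
      exact hs.2.2.1

/-- If a controller stabilizes `p` and its closed loop with `p` is divisible by `θ`, then it is
robustly regulating for every generator with denominator `θ`. -/
theorem Stabilizes.isRobustlyRegulating {p c : K} (γ θ : A) (h : Stabilizes A c p)
    (h₁ : Stable A ((1 - p * c)⁻¹ / algebraMap A K θ))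
    (h₂ : Stable A (p * (1 - p * c)⁻¹ / algebraMap A K θ)) :
    IsRobustlyRegulating A (algebraMap A K γ / algebraMap A K θ) p c := by
  refine ⟨h, fun p' ⟨hne, hS, hpS, hcS⟩ ↦ ?_⟩
  have e := sensitivity_sub h.1
  have e' := sensitivity_sub hne
  have hγ : Stable A (algebraMap A K γ) := stable_algebraMap γ
  set S := (1 - p * c)⁻¹
  set S' := (1 - p' * c)⁻¹
  set t := algebraMap A K θ
  set g := algebraMap A K γ
  constructor
  · have : g / t * S' = g * (S' * (S / t) - p * S / t * (c * S')) := by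
      linear_combination -(g / t * S') * e
    rw [this]
    exact hγ.mul ((hS.mul h₁).sub (h₂.mul hcS))
  · have : g / t * p' * S' = g * (p' * S' * (S / t) - p * S / t * (S' - 1)) := by
      linear_combination -(g / t * p' * S') * e + (g * p * S / t) * e'
    rw [this]
    exact hγ.mul ((hpS.mul h₁).sub (h₂.mul (hS.sub .one)))

end Helpers

theorem stmt17 (A : Type*) {K : Type*} [CommRing A] [IsDomain A] [Field K] [Algebra A K]
    [IsFractionRing A K] (p Θ : K) (γ θ : A) (hθ : θ ≠ 0)
    (hΘ : Θ = algebraMap A K γ / algebraMap A K θ)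
    (hwc : ∀ k : K, Stable A (k * algebraMap A K γ) → Stable A (k * algebraMap A K θ) →
      Stable A k)
    (hsolv : ∃ c' : K, IsRobustlyRegulating A Θ p c') (c : K) :
    IsRobustlyRegulating A Θ p c ↔
      ∃ c₀ : K, Stabilizes A c₀ (p / algebraMap A K θ) ∧ c = c₀ / algebraMap A K θ := by
  have ht : algebraMap A K θ ≠ 0 := by simpa using hθ
  subst hΘ
  have hθs : Stable A (algebraMap A K θ) := stable_algebraMap θ
  constructor
  · intro h
    have hd := h.stable_div hθ hwc
    obtain ⟨hne, hS, -, hcS⟩ := h.1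
    refine ⟨c * algebraMap A K θ, ?_, (mul_div_cancel_right₀ c ht).symm⟩
    have hpc : p / algebraMap A K θ * (c * algebraMap A K θ) = p * c := by field_simp
    unfold Stabilizes
    rw [hpc, div_mul_eq_mul_div, mul_right_comm]
    exact ⟨hne, hS, hd.2, hcS.mul hθs⟩
  · rintro ⟨c₀, h, rfl⟩
    obtain ⟨c', h'⟩ := hsolv
    obtain ⟨hd₁, hd₂⟩ := h'.stable_div hθ hwc
    obtain ⟨hne', -, -, hcS'⟩ := h'.1
    unfold Stabilizes at h
    rw [div_mul_eq_mul_div p, ← mul_div_assoc' p] at h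
    obtain ⟨hne, hS, hpS, hcS⟩ := h
    rw [div_mul_eq_mul_div] at hpS
    have e := sensitivity_sub hne
    have e' := sensitivity_sub hne'
    set S := (1 - p * (c₀ / algebraMap A K θ))⁻¹
    set S' := (1 - p * c')⁻¹
    set t := algebraMap A K θ
    have hSt : Stable A (S / t) := by
      have : S / t = S * (S' / t) - p * S / t * (c' * S') := by
        linear_combination -(S / t) * e'
      rw [this]
      exact (hS.mul hd₁).sub (hpS.mul hcS')
    have hcSt : Stable A (c₀ / t * S) := by
      have : c₀ / t * S = c₀ * S * (S' / t) - (S - 1) * (c' * S') := by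
        linear_combination -(c₀ / t * S) * e' + (c' * S') * e
      rw [this]
      exact (hcS.mul hd₁).sub ((hS.sub .one).mul hcS')
    have hpS' : Stable A (p * S) := by
      simpa [div_mul_cancel₀ _ ht] using hpS.mul hθs
    exact Stabilizes.isRobustlyRegulating γ θ ⟨hne, hS, hpS', hcSt⟩ hSt hpS
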